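/- For any integers 0 ≤ k < n there exists a closed set B ⊆ ℝⁿ of Hausdorff dimension exactly k that contains the k-skeleton of a rotated cube centered at every point of ℝⁿ: for every x ∈ ℝⁿ there exist r > 0 and a linear isometry O of ℝⁿ (a rotation, O in the orthogonal group) such that {x + O(y) : y ∈ skelₖ(0, r)} ⊆ B. -/

import Mathlib

open scoped ENNReal

/-- The `k`-skeleton of the axis-parallel cube in `ℝⁿ` with center `x` and half side
length `r`: points `y` of the cube surface lying on a face of dimension at most `k`,
i.e. `|yᵢ - xᵢ| ≤ r` for all `i` and `|yᵢ - xᵢ| = r` for at least `n - k` indices `i`. -/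
def cubeSkeleton (n k : ℕ) (x : EuclideanSpace ℝ (Fin n)) (r : ℝ) :
    Set (EuclideanSpace ℝ (Fin n)) :=
  {y | (∀ i, |y i - x i| ≤ r) ∧ n - k ≤ {i | |y i - x i| = r}.ncard}


section hausdorff
open MeasureTheory Measure Filter Topology Metric Set
open scoped NNReal

/-- A countable cover by sets of small diameter and small `d`-dimensional content. -/
def SmallCover {X : Type*} [PseudoEMetricSpace X] (D : Set X) (d : ℝ) (ε : ℝ≥0∞) : Prop :=
  ∃ t : ℕ → Set X, D ⊆ ⋃ j, t j ∧ (∀ j, ediam (t j) ≤ ε) ∧ ∑' j, ediam (t j) ^ d ≤ ε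

lemma SmallCover.mono {X : Type*} [PseudoEMetricSpace X] {D D' : Set X} {d : ℝ} {ε : ℝ≥0∞}
    (h : SmallCover D d ε) (hD : D' ⊆ D) : SmallCover D' d ε := by
  obtain ⟨t, h1, h2⟩ := h
  exact ⟨t, hD.trans h1, h2⟩

lemma dimH_le_of_smallCover {X : Type*} [EMetricSpace X] {D : Set X} {k : ℕ}
    (h : ∀ m : ℕ, SmallCover D (k + 1 / ((m : ℝ) + 1)) (((m : ℝ≥0∞) + 1)⁻¹)) :
    dimH D ≤ k := by
  borelize X
  choose t ht1 ht2 ht3 using h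
  have key : ∀ d : ℝ≥0, (k : ℝ≥0) < d → dimH D ≤ d := by
    intro d hd
    apply dimH_le_of_hausdorffMeasure_ne_top
    have hlim : Tendsto (fun m : ℕ => ((m : ℝ≥0∞) + 1)⁻¹) atTop (𝓝 0) := by
      have := (tendsto_add_atTop_iff_nat 1).2 ENNReal.tendsto_inv_nat_nhds_zero
      simpa using this
    have h1 := hausdorffMeasure_le_liminf_tsum (d : ℝ) D _ hlim t
      (Eventually.of_forall ht2) (Eventually.of_forall ht1)
    refine ne_top_of_le_ne_top ENNReal.one_ne_top (h1.trans ?_)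
    have h2 : ∀ᶠ m : ℕ in atTop, ∑' i, ediam (t m i) ^ (d : ℝ) ≤ 1 := by
      have h3 : ∀ᶠ m : ℕ in atTop, 1 / ((m : ℝ) + 1) < d - k := by
        have : (0 : ℝ) < d - k := by
          have : (k : ℝ) < d := by exact_mod_cast hd
          linarith
        exact tendsto_one_div_add_atTop_nhds_zero_nat.eventually_lt_const this
      filter_upwards [h3] with m hm
      have hle : ((m : ℝ≥0∞) + 1)⁻¹ ≤ 1 := by simp
      calc ∑' i, ediam (t m i) ^ (d : ℝ) ≤ ∑' i, ediam (t m i) ^ (k + 1 / ((m : ℝ) + 1)) := by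
            apply ENNReal.tsum_le_tsum
            intro i
            exact ENNReal.rpow_le_rpow_of_exponent_ge ((ht2 m i).trans hle) (by linarith)
        _ ≤ _ := ht3 m
        _ ≤ 1 := hle
    exact liminf_le_of_frequently_le' h2.frequently
  apply le_of_forall_gt
  intro c hc
  obtain ⟨d, hd1, hd2⟩ := ENNReal.lt_iff_exists_nnreal_btwn.1 hc
  exact (key d (by exact_mod_cast hd1)).trans_lt hd2

lemma exists_open_smallCover {X : Type*} [EMetricSpace X] [MeasurableSpace X] [BorelSpace X]
    {D : Set X} {d : ℝ} (hd : 0 < d) (h0 : μH[d] D = 0) {ε : ℝ≥0∞} (hε : 0 < ε) (hε' : ε ≠ ⊤) :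
    ∃ U, IsOpen U ∧ D ⊆ U ∧ SmallCover U d ε := by
  rw [hausdorffMeasure_apply] at h0
  simp only [ENNReal.iSup_eq_zero] at h0
  have hε2 : 0 < ε / 2 := ENNReal.half_pos hε.ne'
  have h1 := h0 (ε / 2) hε2
  have h2 := h1.trans_lt hε2
  simp only [iInf_lt_iff] at h2
  obtain ⟨t, ht1, ht2, ht3⟩ := h2
  have e : ∀ j, (⨆ _ : (t j).Nonempty, ediam (t j) ^ d) = ediam (t j) ^ d := by
    intro j
    rcases (t j).eq_empty_or_nonempty with h | h
    · simp [h, hd]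
    · simp [h]
  simp only [e] at ht3
  obtain ⟨δ, hδ, hδs⟩ := ENNReal.exists_pos_sum_of_countable' hε2.ne' ℕ
  have hη : ∀ j, ∃ η : ℝ≥0, 0 < η ∧ ediam (t j) + 2 * η ≤ ε ∧
      (ediam (t j) + 2 * η) ^ d ≤ ediam (t j) ^ d + δ j := by
    intro j
    have hfin : ediam (t j) ≠ ⊤ :=
      ne_top_of_le_ne_top (ENNReal.div_ne_top hε' (by simp)) (ht2 j)
    have hc : Tendsto (fun η : ℝ≥0 => ediam (t j) + 2 * (η : ℝ≥0∞)) (𝓝 0)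
        (𝓝 (ediam (t j))) := by
      have : Tendsto (fun η : ℝ≥0 => (η : ℝ≥0∞)) (𝓝 0) (𝓝 0) := by
        simpa using ENNReal.continuous_coe.tendsto (0 : ℝ≥0)
      have := (ENNReal.Tendsto.const_mul (a := 2) this (Or.inr (by simp))).const_add (ediam (t j))
      simpa using this
    have hc2 := (ENNReal.continuous_rpow_const (y := d)).tendsto (ediam (t j)) |>.comp hc
    have a1 : ∀ᶠ η : ℝ≥0 in 𝓝 0, ediam (t j) + 2 * (η : ℝ≥0∞) < ε :=
      hc.eventually_lt_const ((ht2 j).trans_lt (ENNReal.half_lt_self hε.ne' hε'))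
    have a2 : ∀ᶠ η : ℝ≥0 in 𝓝 0, (ediam (t j) + 2 * (η : ℝ≥0∞)) ^ d < ediam (t j) ^ d + δ j :=
      hc2.eventually_lt_const (ENNReal.lt_add_right
        (ENNReal.rpow_ne_top_of_nonneg hd.le hfin) (hδ j).ne')
    have a3 : ∀ᶠ η : ℝ≥0 in 𝓝[>] 0, 0 < η := self_mem_nhdsWithin
    obtain ⟨η, h1, h2, h3⟩ := (a3.and ((a1.and a2).filter_mono nhdsWithin_le_nhds)).exists
    exact ⟨η, h1, h2.le, h3.le⟩
  choose η hη0 hη1 hη2 using hη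
  refine ⟨⋃ j, thickening (η j) (t j), isOpen_iUnion fun j => isOpen_thickening, ?_, ?_⟩
  · refine ht1.trans (iUnion_mono fun j => self_subset_thickening (by exact_mod_cast hη0 j) _)
  · refine ⟨_, subset_rfl, fun j => (ediam_thickening_le _).trans (hη1 j), ?_⟩
    calc ∑' j, ediam (thickening (η j) (t j)) ^ d ≤ ∑' j, (ediam (t j) ^ d + δ j) := by
          apply ENNReal.tsum_le_tsum
          intro j
          exact (ENNReal.rpow_le_rpow (ediam_thickening_le _) hd.le).trans (hη2 j)
      _ = ∑' j, ediam (t j) ^ d + ∑' j, δ j := ENNReal.tsum_add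
      _ ≤ ε / 2 + ε / 2 := add_le_add ht3.le hδs.le
      _ = ε := ENNReal.add_halves ε

end hausdorff
section rotation
variable {E : Type*} [NormedAddCommGroup E] [InnerProductSpace ℝ E]

/-- Reflection in the hyperplane orthogonal to a unit vector `c`. -/
noncomputable def reflU (c : E) : E →L[ℝ] E :=
  ContinuousLinearMap.id ℝ E - (2 : ℝ) • (innerSL ℝ c).smulRight c

lemma reflU_apply (c z : E) : reflU c z = z - (2 * (inner ℝ c z : ℝ)) • c := by
  simp [reflU, smul_smul]

lemma norm_reflU (c z : E) (hc : ‖c‖ = 1) : ‖reflU c z‖ = ‖z‖ := by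
  have : ‖reflU c z‖ ^ 2 = ‖z‖ ^ 2 := by
    rw [reflU_apply, norm_sub_sq_real, norm_smul, hc, inner_smul_right, real_inner_comm]
    rw [mul_one, Real.norm_eq_abs, sq_abs]
    ring
  exact (sq_eq_sq₀ (norm_nonneg _) (norm_nonneg _)).1 this

lemma norm_reflU_sub (a c z : E) (ha : ‖a‖ = 1) (hc : ‖c‖ = 1) :
    ‖reflU a z - reflU c z‖ ≤ 4 * ‖a - c‖ * ‖z‖ := by
  have e : reflU a z - reflU c z = (2 * (inner ℝ (c - a) z : ℝ)) • c + (2 * (inner ℝ a z : ℝ)) • (c - a) := by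
    rw [reflU_apply, reflU_apply, inner_sub_left, smul_sub]
    module
  rw [e]
  have h1 := abs_real_inner_le_norm (c - a) z
  have h2 := abs_real_inner_le_norm a z
  calc _ ≤ ‖(2 * (inner ℝ (c - a) z : ℝ)) • c‖ + ‖(2 * (inner ℝ a z : ℝ)) • (c - a)‖ := norm_add_le _ _
    _ = 2 * |(inner ℝ (c - a) z : ℝ)| + 2 * |(inner ℝ a z : ℝ)| * ‖c - a‖ := by
      rw [norm_smul, norm_smul, hc, Real.norm_eq_abs, Real.norm_eq_abs, abs_mul, abs_mul]
      norm_num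
    _ ≤ 2 * (‖c - a‖ * ‖z‖) + 2 * (‖a‖ * ‖z‖) * ‖c - a‖ := by gcongr
    _ = _ := by rw [ha, norm_sub_rev a c]; ring

lemma norm_sub_normalize (a c : E) (ha : ‖a‖ = 1) (hc : c ≠ 0) :
    ‖a - (‖c‖⁻¹) • c‖ ≤ 2 * ‖a - c‖ := by
  have hc' : ‖c‖ ≠ 0 := norm_ne_zero_iff.2 hc
  have e : a - (‖c‖⁻¹) • c = (a - c) + (1 - ‖c‖⁻¹) • c := by module
  have h2 : ‖(1 - ‖c‖⁻¹) • c‖ ≤ ‖a - c‖ := by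
    have : ‖(1 - ‖c‖⁻¹) • c‖ = |‖a‖ - ‖c‖| := by
      rw [norm_smul, Real.norm_eq_abs, ← abs_norm c, ← abs_mul, abs_norm, ha, abs_sub_comm]
      congr 1
      field_simp
    rw [this]
    exact abs_norm_sub_norm_le _ _
  rw [e]
  linarith [norm_add_le (a - c) ((1 - ‖c‖⁻¹) • c)]

lemma exists_rot (a b : E) (ha : ‖a‖ = 1) (hb : ‖b‖ = 1) (hab : ‖a - b‖ < 1) :
    ∃ R : E →L[ℝ] E, (∀ z, ‖R z‖ = ‖z‖) ∧ R a = b ∧ (∀ z, (inner ℝ a z : ℝ) = 0 → (inner ℝ b z : ℝ) = 0 → R z = z) ∧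
      ∀ z, ‖R z - z‖ ≤ 4 * ‖a - b‖ * ‖z‖ := by
  set c₀ : E := (2⁻¹ : ℝ) • (a + b) with hc₀
  have hac : ‖a - c₀‖ = ‖a - b‖ / 2 := by
    have : a - c₀ = (2⁻¹ : ℝ) • (a - b) := by rw [hc₀]; module
    rw [this, norm_smul]; norm_num; ring
  have hc0 : c₀ ≠ 0 := by
    intro h
    rw [h, sub_zero, ha] at hac
    linarith
  set c : E := (‖c₀‖⁻¹) • c₀ with hcdef
  have hc : ‖c‖ = 1 := norm_smul_inv_norm hc0
  have hacn : ‖a - c‖ ≤ ‖a - b‖ := by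
    have := norm_sub_normalize a c₀ ha hc0
    rw [hac] at this; linarith
  have hca : ∀ z, (inner ℝ a z : ℝ) = 0 → (inner ℝ b z : ℝ) = 0 → (inner ℝ c z : ℝ) = 0 := by
    intro z h1 h2
    rw [hcdef, hc₀, inner_smul_left, inner_smul_left, inner_add_left, h1, h2]; simp
  have hcc : reflU c a = - b := by
    have h1 : ‖c₀‖ ^ 2 = (inner ℝ c₀ a : ℝ) := by
      rw [hc₀, norm_smul, mul_pow, norm_add_sq_real, inner_smul_left, inner_add_left, ha, hb,
        real_inner_self_eq_norm_sq, ha, real_inner_comm b a]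
      norm_num
      ring
    have h0 : ‖c₀‖ ≠ 0 := norm_ne_zero_iff.2 hc0
    have : (2 * (inner ℝ c a : ℝ)) • c = (2 : ℝ) • c₀ := by
      rw [hcdef, inner_smul_left, ← h1, smul_smul]
      congr 1
      simp only [RCLike.conj_to_real]
      field_simp
    rw [reflU_apply, this, hc₀]
    module
  have haa : reflU a a = - a := by
    rw [reflU_apply, real_inner_self_eq_norm_sq, ha]; module
  refine ⟨(reflU c).comp (reflU a), ?_, ?_, ?_, ?_⟩
  · intro z; simp [norm_reflU, ha, hc]
  · simp [haa, hcc]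
  · intro z h1 h2
    have h3 := hca z h1 h2
    simp [reflU_apply, h1, h3]
  · intro z
    have hinv : reflU c (reflU c z) = z := by
      rw [reflU_apply c (reflU c z), reflU_apply, inner_sub_right, inner_smul_right,
        real_inner_self_eq_norm_sq, hc]
      module
    have : (reflU c).comp (reflU a) z - z = reflU c (reflU a z - reflU c z) := by
      rw [map_sub, hinv]; rfl
    rw [this, norm_reflU _ _ hc]
    refine (norm_reflU_sub a c z ha hc).trans ?_
    gcongr

lemma exists_sim (w w' : E) (hw : 1 ≤ ‖w‖) (hww : ‖w - w'‖ < 1 / 2) :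
    ∃ (M : E →L[ℝ] E) (s : ℝ), (∀ z, ‖M z‖ = s * ‖z‖) ∧ M w = w' ∧
      (∀ z, (inner ℝ w z : ℝ) = 0 → (inner ℝ w' z : ℝ) = 0 → M z = s • z) ∧
      ∀ z, ‖M z - z‖ ≤ 20 * ‖w - w'‖ * ‖z‖ := by
  have hw0 : ‖w‖ ≠ 0 := by positivity
  have hw'1 : 1 / 2 < ‖w'‖ := by
    have := norm_sub_norm_le w w'; linarith
  have hw'0 : ‖w'‖ ≠ 0 := by positivity
  set a := ‖w‖⁻¹ • w with ha
  set b := ‖w'‖⁻¹ • w' with hb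
  have ha1 : ‖a‖ = 1 := norm_smul_inv_norm (norm_ne_zero_iff.1 hw0)
  have hb1 : ‖b‖ = 1 := norm_smul_inv_norm (norm_ne_zero_iff.1 hw'0)
  have hwa : w = ‖w‖ • a := by rw [ha, smul_smul, mul_inv_cancel₀ hw0, one_smul]
  have hwb : w' = ‖w'‖ • b := by rw [hb, smul_smul, mul_inv_cancel₀ hw'0, one_smul]
  have hinv : ‖w‖⁻¹ ≤ 1 := inv_le_one_of_one_le₀ hw
  have hb2 : b = ‖‖w‖⁻¹ • w'‖⁻¹ • (‖w‖⁻¹ • w') := by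
    rw [hb, norm_smul, norm_inv, norm_norm, smul_smul]
    congr 1
    field_simp
  have hab : ‖a - b‖ ≤ 2 * ‖w - w'‖ := by
    rw [hb2]
    refine (norm_sub_normalize a (‖w‖⁻¹ • w') ha1 ?_).trans ?_
    · rw [← norm_ne_zero_iff, norm_smul, norm_inv, norm_norm]; positivity
    · rw [ha, ← smul_sub, norm_smul, norm_inv, norm_norm]
      have := mul_le_mul_of_nonneg_right hinv (norm_nonneg (w - w'))
      linarith
  obtain ⟨R, h1, h2, h3, h4⟩ := exists_rot a b ha1 hb1 (by linarith)
  set s := ‖w'‖ / ‖w‖ with hs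
  have hs0 : 0 ≤ s := by positivity
  have hs1 : |s - 1| ≤ ‖w - w'‖ := by
    have : s - 1 = ‖w‖⁻¹ * (‖w'‖ - ‖w‖) := by rw [hs]; field_simp
    rw [this, abs_mul, abs_of_nonneg (by positivity), abs_sub_comm]
    have h := abs_norm_sub_norm_le w w'
    calc _ ≤ 1 * |‖w‖ - ‖w'‖| := by gcongr
      _ ≤ _ := by linarith
  refine ⟨s • R, s, ?_, ?_, ?_, ?_⟩
  · intro z
    rw [smul_apply, norm_smul, h1, Real.norm_of_nonneg hs0]
  · rw [smul_apply]
    nth_rewrite 1 [hwa]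
    rw [map_smul, h2, smul_smul, hs, div_mul_cancel₀ _ hw0, ← hwb]
  · intro z hz hz'
    rw [smul_apply, h3]
    · rw [ha, inner_smul_left, hz, mul_zero]
    · rw [hb, inner_smul_left, hz', mul_zero]
  · intro z
    have e : (s • R) z - z = (s - 1) • R z + (R z - z) := by
      rw [smul_apply]; module
    rw [e]
    calc _ ≤ ‖(s - 1) • R z‖ + ‖R z - z‖ := norm_add_le _ _
      _ ≤ ‖w - w'‖ * ‖z‖ + 4 * (2 * ‖w - w'‖) * ‖z‖ := by
        gcongr
        · rw [norm_smul, h1, Real.norm_eq_abs]; gcongr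
        · refine (h4 z).trans ?_; gcongr
      _ ≤ _ := by nlinarith [mul_nonneg (norm_nonneg (w - w')) (norm_nonneg z)]

end rotation
section local_step
open MeasureTheory Measure Filter Topology Metric Set
open scoped NNReal
variable {E : Type*} [NormedAddCommGroup E] [InnerProductSpace ℝ E]

/-- Linear similarities. -/
def Simil (A : E →L[ℝ] E) : Prop := ∃ r : ℝ, ∀ z, ‖A z‖ = r * ‖z‖

lemma Simil.inner_eq_zero {A : E →L[ℝ] E} (h : Simil A) {x y : E} (hxy : inner ℝ x y = (0 : ℝ)) :
    inner ℝ (A x) (A y) = (0 : ℝ) := by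
  obtain ⟨r, hr⟩ := h
  rw [real_inner_eq_norm_add_mul_self_sub_norm_mul_self_sub_norm_mul_self_div_two] at hxy ⊢
  rw [← map_add, hr, hr, hr]
  linear_combination r ^ 2 * hxy

lemma exists_adjust [FiniteDimensional ℝ E] (V : Submodule ℝ E) (v : E)
    (hv : ∀ u ∈ V, inner ℝ v u = (0 : ℝ)) (hv1 : 1 ≤ ‖v‖) (A : E →L[ℝ] E) (hA : Simil A)
    (hA1 : ∀ z, ‖z‖ ≤ ‖A z‖) (hA3 : ‖A‖ ≤ 3) (x₀ x : E) (hx : ‖x - x₀‖ < 1 / 2) :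
    ∃ A' : E →L[ℝ] E, Simil A' ∧
      x + A' v - (x₀ + A v) ∈ V.map (A : E →ₗ[ℝ] E) ∧
      (∀ u ∈ V, A' u ∈ V.map (A : E →ₗ[ℝ] E)) ∧ ‖A' - A‖ ≤ 60 * ‖x - x₀‖ := by
  set W := V.map (A : E →ₗ[ℝ] E) with hW
  set h := x - x₀ with hh
  set h' := Wᗮ.starProjection h with hh'
  have hle : ‖h'‖ ≤ ‖h‖ := Wᗮ.norm_starProjection_apply_le h
  have hW' : h' ∈ Wᗮ := Submodule.starProjection_apply_mem _ _
  have hhW : h - h' ∈ W := by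
    have := Submodule.sub_starProjection_mem_orthogonal (K := Wᗮ) h
    rwa [Submodule.orthogonal_orthogonal] at this
  have hwW : ∀ z ∈ W, inner ℝ (A v) z = (0 : ℝ) := by
    rintro z ⟨u, hu, rfl⟩
    exact hA.inner_eq_zero (hv u hu)
  have hwW' : ∀ z ∈ W, inner ℝ (A v - h') z = (0 : ℝ) := by
    intro z hz
    rw [inner_sub_left, hwW z hz, Submodule.inner_left_of_mem_orthogonal hz hW', sub_zero]
  obtain ⟨M, s, h1, h2, h3, h4⟩ := exists_sim (A v) (A v - h') (hv1.trans (hA1 v))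
    (by rw [sub_sub_cancel]; linarith)
  rw [sub_sub_cancel] at h4
  refine ⟨M.comp A, ?_, ?_, ?_, ?_⟩
  · obtain ⟨r, hr⟩ := hA
    exact ⟨s * r, fun z => by simp [h1, hr, mul_assoc]⟩
  · have : x + (M.comp A) v - (x₀ + A v) = h - h' := by
      rw [ContinuousLinearMap.comp_apply, h2, hh]; abel
    rw [this]; exact hhW
  · intro u hu
    have hAu : A u ∈ W := ⟨u, hu, rfl⟩
    rw [ContinuousLinearMap.comp_apply, h3 _ (hwW _ hAu) (hwW' _ hAu)]
    exact W.smul_mem _ hAu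
  · refine ContinuousLinearMap.opNorm_le_bound _ (by positivity) fun z => ?_
    calc ‖(M.comp A - A) z‖ ≤ 20 * ‖h'‖ * ‖A z‖ := h4 (A z)
      _ ≤ 20 * ‖h‖ * (3 * ‖z‖) := by
        gcongr
        exact (A.le_opNorm z).trans (by gcongr)
      _ = _ := by ring

/-- The union of the copies of `F` placed at the points of `C`. -/
def placed (C : Set E) (A : E → E →L[ℝ] E) (F : Set E) : Set E :=
  {p | ∃ x ∈ C, ∃ y ∈ F, x + A x y = p}

lemma norm_bounds {A : E →L[ℝ] E} (h : ‖A - (2 : ℝ) • ContinuousLinearMap.id ℝ E‖ ≤ 1) :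
    (∀ z, ‖z‖ ≤ ‖A z‖) ∧ ‖A‖ ≤ 3 := by
  have h1 : ∀ z, ‖A z - (2 : ℝ) • z‖ ≤ ‖z‖ := fun z => by
    have := (A - (2 : ℝ) • ContinuousLinearMap.id ℝ E).le_of_opNorm_le h z
    simpa using this
  have h2 : ∀ z : E, ‖(2 : ℝ) • z‖ = 2 * ‖z‖ := fun z => by rw [norm_smul]; norm_num
  constructor
  · intro z
    have := norm_sub_norm_le ((2 : ℝ) • z) (A z)
    rw [norm_sub_rev, h2] at this
    linarith [h1 z]
  · refine ContinuousLinearMap.opNorm_le_bound _ (by norm_num) fun z => ?_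
    have := norm_sub_norm_le (A z) ((2 : ℝ) • z)
    rw [h2] at this
    linarith [h1 z]

lemma dimH_plane_le [FiniteDimensional ℝ E] (W : Submodule ℝ E) (c : E) :
    dimH {p | p - c ∈ W} ≤ Module.finrank ℝ W := by
  have : {p | p - c ∈ W} = range (fun w : W => (w : E) + c) := by
    ext p
    constructor
    · intro h
      exact ⟨⟨p - c, h⟩, by simp⟩
    · rintro ⟨w, rfl⟩
      simp
  rw [this, ← Real.dimH_univ_eq_finrank]
  have hl : LipschitzWith 1 (fun w : W => (w : E) + c) := by
    apply LipschitzWith.of_dist_le_mul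
    intro a b
    simp [Subtype.dist_eq]
  exact hl.dimH_range_le

lemma exists_step [FiniteDimensional ℝ E] (k : ℕ) (V : Submodule ℝ E)
    (hV : Module.finrank ℝ V ≤ k) (v : E)
    (hv : ∀ u ∈ V, inner ℝ v u = (0 : ℝ)) (hv1 : 1 ≤ ‖v‖) (F : Set E) (K : ℝ) (hK : 0 < K)
    (hF : ∀ y ∈ F, y - v ∈ V ∧ ‖y‖ ≤ K) (C : Set E) (hC : Bornology.IsBounded C) (m : ℕ)
    (A : E → E →L[ℝ] E) (ε : ℝ) (hε : 0 < ε) (hε1 : ε ≤ 1)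
    (hA : ∀ x, Simil (A x) ∧ ‖A x - (2 : ℝ) • ContinuousLinearMap.id ℝ E‖ ≤ 1) :
    ∃ A' : E → E →L[ℝ] E, (∀ x, Simil (A' x) ∧ ‖A' x - A x‖ ≤ ε) ∧
      ∃ ρ > 0, ∀ A'' : E → E →L[ℝ] E, (∀ x, ‖A'' x - A' x‖ ≤ ρ) →
        SmallCover (closure (placed C A'' F)) (k + 1 / ((m : ℝ) + 1)) (((m : ℝ≥0∞) + 1)⁻¹) := by
  classical
  borelize E
  obtain ⟨R, hR⟩ := hC.subset_closedBall 0
  have hbd : Bornology.IsBounded ((fun x => (x, A x)) '' C) := by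
    apply (hC.prod (isBounded_closedBall (x := (0 : E →L[ℝ] E)) (r := 3))).subset
    rintro _ ⟨x, hx, rfl⟩
    exact ⟨hx, by simpa using (norm_bounds (hA x).2).2⟩
  have htb : TotallyBounded ((fun x => (x, A x)) '' C) := hbd.isCompact_closure.totallyBounded.subset
    subset_closure
  obtain ⟨t, htC, htf, htcov⟩ := Metric.finite_approx_of_totallyBounded htb (ε / 200) (by positivity)
  have hch : ∀ x, ∃ A' : E →L[ℝ] E, (Simil A' ∧ ‖A' - A x‖ ≤ ε) ∧ (x ∈ C → ∃ q ∈ t,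
      x + A' v - (q.1 + q.2 v) ∈ V.map (q.2 : E →ₗ[ℝ] E) ∧
      (∀ u ∈ V, A' u ∈ V.map (q.2 : E →ₗ[ℝ] E))) := by
    intro x
    by_cases hx : x ∈ C
    · have := htcov ⟨x, hx, rfl⟩
      simp only [mem_iUnion] at this
      obtain ⟨q, hqt, hq⟩ := this
      obtain ⟨x₀, hx₀, rfl⟩ := htC hqt
      rw [mem_ball, Prod.dist_eq, max_lt_iff, dist_eq_norm, dist_eq_norm] at hq
      simp only at hq
      obtain ⟨b1, b3⟩ := norm_bounds (hA x₀).2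
      obtain ⟨A', s1, s2, s3, s4⟩ := exists_adjust V v hv hv1 (A x₀) (hA x₀).1 b1 b3 x₀ x
        (by linarith [hq.1])
      refine ⟨A', ⟨s1, ?_⟩, fun _ => ⟨_, hqt, s2, s3⟩⟩
      have e : A' - A x = (A' - A x₀) - (A x - A x₀) := by abel
      rw [e]
      have := norm_sub_le (A' - A x₀) (A x - A x₀)
      linarith [hq.1, hq.2]
    · exact ⟨A x, ⟨(hA x).1, by simpa using hε.le⟩, fun h => absurd h hx⟩
  choose A' hA'1 hA'2 using hch
  refine ⟨A', hA'1, ?_⟩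
  set D : Set E := (⋃ q ∈ t, {p | p - (q.1 + q.2 v) ∈ V.map (q.2 : E →ₗ[ℝ] E)}) ∩
    closedBall 0 (R + 4 * K) with hD
  have hDc : IsCompact D := by
    refine (isCompact_closedBall _ _).inter_left ?_
    refine htf.isClosed_biUnion fun q _ => ?_
    exact (Submodule.closed_of_finiteDimensional (V.map (q.2 : E →ₗ[ℝ] E))).preimage
      (by fun_prop : Continuous fun p : E => p - (q.1 + q.2 v))
  have hDdim : dimH D ≤ k := by
    refine (dimH_mono inter_subset_left).trans ?_
    rw [dimH_bUnion htf.countable]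
    refine iSup₂_le fun q _ => (dimH_plane_le _ _).trans ?_
    exact_mod_cast (Submodule.finrank_map_le _ _).trans hV
  have hd0 : (0 : ℝ) < 1 / ((m : ℝ) + 1) := by positivity
  have hd : (0 : ℝ) < k + 1 / ((m : ℝ) + 1) := by positivity
  have hμ : μH[k + 1 / ((m : ℝ) + 1)] D = 0 := by
    lift (k + 1 / ((m : ℝ) + 1) : ℝ) to ℝ≥0 using hd.le with d hdd
    apply hausdorffMeasure_of_dimH_lt
    refine hDdim.trans_lt ?_
    have : (k : ℝ) < d := by rw [hdd]; linarith
    exact_mod_cast this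
  obtain ⟨U, hUo, hDU, hU⟩ := exists_open_smallCover hd hμ (ε := ((m : ℝ≥0∞) + 1)⁻¹)
    (by simp) (by simp)
  obtain ⟨δ, hδ, hδU⟩ := hDc.exists_cthickening_subset_open hUo hDU
  refine ⟨δ / K, by positivity, fun A'' hA'' => hU.mono (Subset.trans ?_ hδU)⟩
  refine closure_minimal ?_ isClosed_cthickening
  rintro _ ⟨x, hx, y, hy, rfl⟩
  have hyF := hF y hy
  refine mem_cthickening_of_dist_le _ (x + A' x y) _ _ ?_ ?_
  · constructor
    · obtain ⟨q, hq, c1, c2⟩ := hA'2 x hx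
      refine mem_biUnion hq ?_
      have e : x + A' x y - (q.1 + q.2 v) = (x + A' x v - (q.1 + q.2 v)) + A' x (y - v) := by
        rw [map_sub]; abel
      rw [mem_ofPred_eq, e]
      exact Submodule.add_mem _ c1 (c2 _ hyF.1)
    · rw [mem_closedBall_zero_iff]
      have hxR : ‖x‖ ≤ R := by simpa using hR hx
      have h4 : ‖A' x‖ ≤ 4 := by
        have e : A' x = (A' x - A x) + A x := by abel
        rw [e]
        linarith [norm_add_le (A' x - A x) (A x), (hA'1 x).2, (norm_bounds (hA x).2).2]
      have h5 : ‖A' x y‖ ≤ 4 * K := ((A' x).le_of_opNorm_le h4 y).trans (by linarith [hyF.2])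
      exact (norm_add_le _ _).trans (by linarith)
  · rw [dist_eq_norm, add_sub_add_left_eq_sub]
    have := (A'' x - A' x).le_of_opNorm_le (hA'' x) y
    calc _ ≤ δ / K * ‖y‖ := this
      _ ≤ δ / K * K := by gcongr; exact hyF.2
      _ = δ := by field_simp

end local_step

section iteration
open Filter Topology

lemma exists_iterate {X Y : Type*} [NormedAddCommGroup Y] [CompleteSpace Y]
    (P : ℕ → (X → Y) → Prop) (Q : Y → Prop) (hQ : IsClosed {y | Q y}) (c : Y) (hc : Q c)
    (H : ∀ (m : ℕ) (A : X → Y) (ε : ℝ), 0 < ε → ε ≤ 1 → (∀ x, Q (A x) ∧ ‖A x - c‖ ≤ 1) →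
      ∃ A' : X → Y, (∀ x, Q (A' x) ∧ ‖A' x - A x‖ ≤ ε) ∧
        ∃ ρ > 0, ∀ A'' : X → Y, (∀ x, ‖A'' x - A' x‖ ≤ ρ) → P m A'') :
    ∃ A : X → Y, (∀ x, Q (A x) ∧ ‖A x - c‖ ≤ 1) ∧ ∀ m, P m A := by
  let S := {p : (X → Y) × ℝ // 0 < p.2 ∧ p.2 ≤ 1 ∧ ∀ x, Q (p.1 x) ∧ ‖p.1 x - c‖ ≤ 1 - p.2}
  have step : ∀ (m : ℕ) (p : S), ∃ q : S, (∀ x, ‖q.1.1 x - p.1.1 x‖ ≤ p.1.2 / 2) ∧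
      q.1.2 ≤ p.1.2 / 2 ∧ ∀ A'' : X → Y, (∀ x, ‖A'' x - q.1.1 x‖ ≤ q.1.2) → P m A'' := by
    rintro m ⟨⟨A, r⟩, hr, hr1, hA⟩
    simp only at hr hr1 hA
    obtain ⟨A', h1, ρ, hρ, h2⟩ := H m A (r / 2) (by linarith) (by linarith)
      fun x => ⟨(hA x).1, by linarith [(hA x).2]⟩
    refine ⟨⟨⟨A', min ρ (r / 2)⟩, lt_min hρ (by linarith), (min_le_right _ _).trans (by linarith),
      fun x => ⟨(h1 x).1, ?_⟩⟩, fun x => (h1 x).2, min_le_right _ _,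
      fun A'' h => h2 A'' fun x => (h x).trans (min_le_left _ _)⟩
    have e : A' x - c = (A' x - A x) + (A x - c) := by abel
    simp only
    rw [e]
    linarith [norm_add_le (A' x - A x) (A x - c), (h1 x).2, (hA x).2, min_le_right ρ (r / 2)]
  choose f hf1 hf2 hf3 using step
  let s : ℕ → S := fun m => Nat.rec ⟨⟨fun _ => c, 1⟩, by simp [hc]⟩ f m
  have hs : ∀ m, s (m + 1) = f m (s m) := fun m => rfl
  have hnest : ∀ j i x, ‖(s (j + i)).1.1 x - (s j).1.1 x‖ ≤ (s j).1.2 - (s (j + i)).1.2 := by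
    intro j i x
    induction i with
    | zero => simp
    | succ i ih =>
      rw [← add_assoc, hs]
      have a1 := hf1 (j + i) (s (j + i)) x
      have a2 := hf2 (j + i) (s (j + i))
      have := norm_add_le ((f (j + i) (s (j + i))).1.1 x - (s (j + i)).1.1 x)
        ((s (j + i)).1.1 x - (s j).1.1 x)
      rw [sub_add_sub_cancel] at this
      linarith
  have hpow : ∀ m, (s m).1.2 ≤ (1 / 2) ^ m := by
    intro m
    induction m with
    | zero => simp [s]
    | succ m ih =>
      rw [hs, pow_succ]
      linarith [hf2 m (s m)]
  have hr0 : Tendsto (fun m => (s m).1.2) atTop (𝓝 0) :=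
    squeeze_zero (fun m => (s m).2.1.le) hpow
      (tendsto_pow_atTop_nhds_zero_of_lt_one (by norm_num) (by norm_num))
  have hnest' : ∀ j i x, j ≤ i → ‖(s i).1.1 x - (s j).1.1 x‖ ≤ (s j).1.2 := by
    intro j i x hij
    obtain ⟨d, rfl⟩ := Nat.exists_eq_add_of_le hij
    linarith [hnest j d x, (s (j + d)).2.1]
  have hcau : ∀ x, ∃ y, Tendsto (fun m => (s m).1.1 x) atTop (𝓝 y) := by
    intro x
    apply cauchySeq_tendsto_of_complete
    refine cauchySeq_of_le_tendsto_0' (fun m => (s m).1.2) ?_ hr0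
    intro j i hij
    rw [dist_comm, dist_eq_norm]
    exact hnest' j i x hij
  choose A hA using hcau
  have hlim : ∀ j x, ‖A x - (s j).1.1 x‖ ≤ (s j).1.2 := by
    intro j x
    refine le_of_tendsto ((hA x).sub_const _).norm ?_
    filter_upwards [eventually_ge_atTop j] with i hi using hnest' j i x hi
  refine ⟨A, fun x => ⟨?_, ?_⟩, fun m => ?_⟩
  · exact hQ.mem_of_tendsto (hA x) (Eventually.of_forall fun m => ((s m).2.2.2 x).1)
  · exact hlim 0 x
  · exact hf3 m (s m) A fun x => hlim (m + 1) x

lemma isClosed_simil {E : Type*} [NormedAddCommGroup E] [InnerProductSpace ℝ E] :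
    IsClosed {A : E →L[ℝ] E | Simil A} := by
  have : {A : E →L[ℝ] E | Simil A} = {A | ∀ z w, ‖A z‖ * ‖w‖ = ‖A w‖ * ‖z‖} := by
    ext A
    constructor
    · rintro ⟨r, hr⟩ z w
      rw [hr, hr]; ring
    · intro h
      by_cases hE : ∃ w : E, w ≠ 0
      · obtain ⟨w, hw⟩ := hE
        have hw' : ‖w‖ ≠ 0 := norm_ne_zero_iff.2 hw
        refine ⟨‖A w‖ / ‖w‖, fun z => ?_⟩
        have := h z w
        field_simp
        linarith
      · push Not at hE
        exact ⟨0, fun z => by simp [hE z]⟩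
  rw [this]
  simp only [Set.ofPred_forall]
  refine isClosed_iInter fun z => isClosed_iInter fun w => isClosed_eq ?_ ?_ <;> fun_prop

end iteration
section final
open MeasureTheory Measure Filter Topology Metric Set
open scoped NNReal



/-- The sign attached to a Boolean. -/
def sgn (b : Bool) : ℝ := if b then 1 else -1

/-- A `k`-face of the standard cube. -/
def cubeFace {n : ℕ} (S : Finset (Fin n)) (σ : Fin n → Bool) : Set (EuclideanSpace ℝ (Fin n)) :=
  {y | (∀ i, |y i| ≤ 1) ∧ ∀ i ∈ S, y i = sgn (σ i)}

/-- The direction of a face. -/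
def faceDir {n : ℕ} (S : Finset (Fin n)) : Submodule ℝ (EuclideanSpace ℝ (Fin n)) where
  carrier := {y | ∀ i ∈ S, y i = 0}
  add_mem' := by
    intro a b ha hb i hi
    simp [ha i hi, hb i hi]
  zero_mem' := by intro i _; simp
  smul_mem' := by
    intro c a ha i hi
    simp [ha i hi]

lemma finrank_faceDir {n k : ℕ} (hk : k < n) (S : Finset (Fin n)) (hS : S.card = n - k) :
    Module.finrank ℝ (faceDir S) ≤ k := by
  let f : faceDir S →ₗ[ℝ] ({i : Fin n // i ∉ S} → ℝ) :=
    { toFun := fun y i => y.1 i.1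
      map_add' := fun a b => by ext i; simp
      map_smul' := fun a b => by ext i; simp }
  have hf : Function.Injective f := by
    intro a b hab
    ext i
    by_cases hi : i ∈ S
    · rw [a.2 i hi, b.2 i hi]
    · exact congrFun hab ⟨i, hi⟩
  have := LinearMap.finrank_le_finrank_of_injective hf
  refine this.trans ?_
  rw [Module.finrank_fintype_fun_eq_card, Fintype.card_subtype_compl]
  simp [hS]
  omega

lemma norm_cube_le {n : ℕ} (y : EuclideanSpace ℝ (Fin n)) (hy : ∀ i, |y i| ≤ 1) : ‖y‖ ≤ n + 1 := by
  have h1 : ‖y‖ ^ 2 ≤ n := by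
    rw [EuclideanSpace.norm_sq_eq]
    calc ∑ i, ‖y i‖ ^ 2 ≤ ∑ _i : Fin n, (1 : ℝ) := by
          apply Finset.sum_le_sum
          intro i _
          rw [Real.norm_eq_abs]
          have := hy i
          nlinarith [abs_nonneg (y i)]
      _ = n := by simp
  nlinarith [norm_nonneg y, sq_nonneg (‖y‖ - 1)]

lemma face_step {n k : ℕ} (hk : k < n) (S : Finset (Fin n)) (hS : S.card = n - k)
    (σ : Fin n → Bool) :
    ∃ v : EuclideanSpace ℝ (Fin n), (∀ u ∈ faceDir S, inner ℝ v u = (0 : ℝ)) ∧ 1 ≤ ‖v‖ ∧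
      ∀ y ∈ cubeFace S σ, y - v ∈ faceDir S ∧ ‖y‖ ≤ n + 1 := by
  refine ⟨WithLp.toLp 2 fun i => if i ∈ S then sgn (σ i) else 0, ?_, ?_, ?_⟩
  · intro u hu
    rw [PiLp.inner_apply]
    refine Finset.sum_eq_zero fun i _ => ?_
    by_cases hi : i ∈ S
    · rw [hu i hi]; simp
    · simp [hi]
  · have : S.Nonempty := by rw [← Finset.card_pos]; omega
    obtain ⟨i, hi⟩ := this
    refine le_trans ?_ (PiLp.norm_apply_le _ i)
    simp only [hi, if_true, sgn]
    split_ifs <;> simp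
  · intro y hy
    refine ⟨fun i hi => ?_, norm_cube_le y hy.1⟩
    simp [hi, hy.2 i hi]

lemma skeleton_subset {n k : ℕ} (y : EuclideanSpace ℝ (Fin n)) (hy : y ∈ cubeSkeleton n k 0 1) :
    ∃ (S : {S : Finset (Fin n) // S.card = n - k}) (σ : Fin n → Bool), y ∈ cubeFace S.1 σ := by
  classical
  obtain ⟨h1, h2⟩ := hy
  simp only [PiLp.zero_apply, sub_zero] at h1 h2
  rw [Set.ncard_eq_toFinset_card'] at h2
  obtain ⟨S, hS1, hS2⟩ := Finset.exists_subset_card_eq h2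
  refine ⟨⟨S, hS2⟩, fun i => decide (0 ≤ y i), h1, fun i hi => ?_⟩
  have h3 : |y i| = 1 := by
    have := hS1 hi
    simpa using this
  unfold sgn
  by_cases h0 : 0 ≤ y i
  · rw [abs_of_nonneg h0] at h3; simp [h0, h3]
  · rw [abs_of_neg (not_le.1 h0)] at h3
    simp only [h0, decide_false, Bool.false_eq_true, if_false]
    linarith

lemma exists_bounded {n k : ℕ} (hk : k < n) (C : Set (EuclideanSpace ℝ (Fin n))) (hC : Bornology.IsBounded C) :
    ∃ A : (EuclideanSpace ℝ (Fin n)) → (EuclideanSpace ℝ (Fin n)) →L[ℝ] (EuclideanSpace ℝ (Fin n)),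
      (∀ x, Simil (A x) ∧ ‖A x - (2 : ℝ) • ContinuousLinearMap.id ℝ (EuclideanSpace ℝ (Fin n))‖ ≤ 1) ∧
      dimH (closure (placed C A (cubeSkeleton n k 0 1))) ≤ k := by
  classical
  let ι := {S : Finset (Fin n) // S.card = n - k} × (Fin n → Bool)
  have hne : Nonempty ι := by
    obtain ⟨S, _, hS⟩ := Finset.exists_subset_card_eq
      (s := (Finset.univ : Finset (Fin n))) (n := n - k) (by simp)
    exact ⟨⟨S, hS⟩, fun _ => true⟩
  obtain ⟨e, he⟩ := exists_surjective_nat (ι × ℕ)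
  obtain ⟨A, hA1, hA2⟩ := exists_iterate
    (fun j (A : (EuclideanSpace ℝ (Fin n)) → (EuclideanSpace ℝ (Fin n)) →L[ℝ] (EuclideanSpace ℝ (Fin n))) =>
      SmallCover (closure (placed C A (cubeFace (e j).1.1.1 (e j).1.2)))
        (k + 1 / (((e j).2 : ℝ) + 1)) ((((e j).2 : ℝ≥0∞) + 1)⁻¹))
    Simil isClosed_simil ((2 : ℝ) • ContinuousLinearMap.id ℝ (EuclideanSpace ℝ (Fin n)))
    ⟨2, fun z => by simp [norm_smul]⟩
    (by
      intro j A ε hε hε1 hA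
      obtain ⟨v, hv1, hv2, hv3⟩ := face_step hk (e j).1.1.1 (e j).1.1.2 (e j).1.2
      exact exists_step k _ (finrank_faceDir hk _ (e j).1.1.2) v hv1 hv2 _ (n + 1)
        (by positivity) hv3 C hC _ A ε hε hε1 hA)
  refine ⟨A, hA1, ?_⟩
  have hsub : closure (placed C A (cubeSkeleton n k 0 1)) ⊆
      ⋃ i : ι, closure (placed C A (cubeFace i.1.1 i.2)) := by
    refine closure_minimal ?_ (isClosed_iUnion_of_finite fun i => isClosed_closure)
    rintro _ ⟨x, hx, y, hy, rfl⟩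
    obtain ⟨S, σ, hyS⟩ := skeleton_subset y hy
    exact mem_iUnion.2 ⟨(S, σ), subset_closure ⟨x, hx, y, hyS, rfl⟩⟩
  refine (dimH_mono hsub).trans ?_
  rw [dimH_iUnion]
  refine iSup_le fun i => dimH_le_of_smallCover fun m => ?_
  obtain ⟨j, hj⟩ := he (i, m)
  have := hA2 j
  simp only [hj] at this
  exact this

lemma le_dimH_skeleton {n k : ℕ} (hk : k < n) (r : ℝ) (hr : 0 < r) :
    (k : ℝ≥0∞) ≤ dimH (cubeSkeleton n k 0 r) := by
  let g : (Fin k → ℝ) → EuclideanSpace ℝ (Fin n) := fun u =>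
    WithLp.toLp 2 fun i => if h : i.1 < k then u ⟨i.1, h⟩ else r
  have hg : AntilipschitzWith 1 g := by
    apply AntilipschitzWith.of_le_mul_dist
    intro a b
    rw [NNReal.coe_one, one_mul, dist_pi_le_iff dist_nonneg]
    intro i
    have := PiLp.norm_apply_le (g a - g b) ⟨i.1, i.2.trans hk⟩
    simpa [g, dist_eq_norm] using this
  have h1 : dimH (closedBall (0 : Fin k → ℝ) r) = k := by
    rw [Real.dimH_of_nonempty_interior]
    · simp
    · exact ⟨0, ball_subset_interior_closedBall (mem_ball_self hr)⟩
  rw [← h1]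
  refine (hg.le_dimH_image _).trans (dimH_mono ?_)
  rintro _ ⟨u, hu, rfl⟩
  rw [mem_closedBall_zero_iff, pi_norm_le_iff_of_nonneg hr.le] at hu
  constructor
  · intro i
    by_cases h : i.1 < k
    · simpa [g, h] using hu ⟨i.1, h⟩
    · simp [g, h, abs_of_pos hr]
  · have hsub : ((Finset.Ici (⟨k, hk⟩ : Fin n) : Finset (Fin n)) : Set (Fin n)) ⊆
        {i | |g u i - (0 : EuclideanSpace ℝ (Fin n)) i| = r} := by
      intro i hi
      have hi' : ¬ i.1 < k := by
        have : (⟨k, hk⟩ : Fin n) ≤ i := by simpa using hi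
        exact not_lt.2 this
      simp [g, hi', abs_of_pos hr]
    have := Set.ncard_le_ncard hsub (Set.toFinite _)
    rw [Set.ncard_coe_finset, Fin.card_Ici] at this
    exact this

end final

theorem rotated_cube_skeletons (n k : ℕ) (hk : k < n) :
    ∃ B : Set (EuclideanSpace ℝ (Fin n)), IsClosed B ∧ dimH B = (k : ℝ≥0∞) ∧
      ∀ x : EuclideanSpace ℝ (Fin n), ∃ r > (0 : ℝ),
        ∃ O : EuclideanSpace ℝ (Fin n) ≃ₗᵢ[ℝ] EuclideanSpace ℝ (Fin n),
          (fun y => x + O y) '' cubeSkeleton n k 0 r ⊆ B := by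
  let C : ℕ → Set (EuclideanSpace ℝ (Fin n)) := fun j => {x | (j : ℝ) ≤ ‖x‖ ∧ ‖x‖ ≤ j + 1}
  have hC : ∀ j, Bornology.IsBounded (C j) := fun j =>
    (Metric.isBounded_closedBall (x := 0) (r := (j : ℝ) + 1)).subset fun x hx => by
      simpa using hx.2
  choose A hA hdim using fun j => exists_bounded hk (C j) (hC j)
  have hfar : ∀ j, closure (placed (C j) (A j) (cubeSkeleton n k 0 1)) ⊆
      {p | (j : ℝ) - 3 * (n + 1) ≤ ‖p‖} := by
    intro j
    refine closure_minimal ?_ (isClosed_le continuous_const continuous_norm)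
    rintro _ ⟨x, hx, y, hy, rfl⟩
    have h1 : ‖y‖ ≤ n + 1 := norm_cube_le y (by simpa using hy.1)
    have h2 : ‖A j x y‖ ≤ 3 * ‖y‖ := (A j x).le_of_opNorm_le (norm_bounds (hA j x).2).2 y
    have h3 := norm_sub_le (x + A j x y) (A j x y)
    rw [add_sub_cancel_right] at h3
    have h4 := hx.1
    show (j : ℝ) - 3 * (n + 1) ≤ ‖x + A j x y‖
    linarith
  have hcl : IsClosed (⋃ j, closure (placed (C j) (A j) (cubeSkeleton n k 0 1))) := by
    refine LocallyFinite.isClosed_iUnion ?_ fun j => isClosed_closure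
    intro p
    refine ⟨Metric.ball p 1, Metric.ball_mem_nhds p one_pos, ?_⟩
    refine (Set.finite_Iic ⌈‖p‖ + 1 + 3 * (n + 1)⌉₊).subset ?_
    rintro j ⟨q, hq1, hq2⟩
    have h1 : (j : ℝ) - 3 * (n + 1) ≤ ‖q‖ := hfar j hq1
    rw [Metric.mem_ball, dist_eq_norm] at hq2
    have h2 := norm_sub_norm_le q p
    have h3 := Nat.le_ceil (‖p‖ + 1 + 3 * ((n : ℝ) + 1))
    rw [Set.mem_Iic]
    have : (j : ℝ) ≤ ⌈‖p‖ + 1 + 3 * ((n : ℝ) + 1)⌉₊ := by linarith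
    exact_mod_cast this
  have hcont : ∀ x : EuclideanSpace ℝ (Fin n), ∃ r > (0 : ℝ),
      ∃ O : EuclideanSpace ℝ (Fin n) ≃ₗᵢ[ℝ] EuclideanSpace ℝ (Fin n),
        (fun y => x + O y) '' cubeSkeleton n k 0 r ⊆
          ⋃ j, closure (placed (C j) (A j) (cubeSkeleton n k 0 1)) := by
    intro x
    set j := ⌊‖x‖⌋₊ with hj
    have hxC : x ∈ C j := ⟨Nat.floor_le (norm_nonneg x), (Nat.lt_floor_add_one ‖x‖).le⟩
    obtain ⟨r, hr⟩ := (hA j x).1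
    have hr1 : 1 ≤ r := by
      have := (norm_bounds (hA j x).2).1 (EuclideanSpace.single (⟨k, hk⟩ : Fin n) (1 : ℝ))
      rw [hr] at this
      simpa using this
    have hr0 : 0 < r := by linarith
    let O₁ : EuclideanSpace ℝ (Fin n) →ₗᵢ[ℝ] EuclideanSpace ℝ (Fin n) :=
      { toLinearMap := (r⁻¹ • A j x : EuclideanSpace ℝ (Fin n) →L[ℝ] EuclideanSpace ℝ (Fin n))
        norm_map' := fun z => by
          show ‖r⁻¹ • A j x z‖ = ‖z‖
          rw [norm_smul, hr, norm_inv, Real.norm_of_nonneg hr0.le]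
          field_simp }
    refine ⟨r, hr0, O₁.toLinearIsometryEquiv rfl, ?_⟩
    rintro _ ⟨y, hy, rfl⟩
    refine Set.mem_iUnion.2 ⟨j, subset_closure ⟨x, hxC, r⁻¹ • y, ?_, ?_⟩⟩
    · have e : ∀ i, |(r⁻¹ • y) i - (0 : EuclideanSpace ℝ (Fin n)) i| =
          r⁻¹ * |y i - (0 : EuclideanSpace ℝ (Fin n)) i| := by
        intro i
        simp [abs_mul, abs_of_pos hr0]
      refine ⟨fun i => ?_, ?_⟩
      · rw [e, inv_mul_le_iff₀ hr0, mul_one]; exact hy.1 i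
      · have e2 : {i | |(r⁻¹ • y) i - (0 : EuclideanSpace ℝ (Fin n)) i| = 1} =
            {i | |y i - (0 : EuclideanSpace ℝ (Fin n)) i| = r} := by
          ext i
          show |(r⁻¹ • y) i - (0 : EuclideanSpace ℝ (Fin n)) i| = 1 ↔ 
            |y i - (0 : EuclideanSpace ℝ (Fin n)) i| = r
          rw [e, inv_mul_eq_iff_eq_mul₀ hr0.ne', mul_one]
        rw [e2]; exact hy.2
    · rw [map_smul]; rfl
  refine ⟨_, hcl, le_antisymm ?_ ?_, hcont⟩
  · rw [dimH_iUnion]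
    exact iSup_le hdim
  · obtain ⟨r, hr, O, hO⟩ := hcont 0
    calc (k : ℝ≥0∞) ≤ dimH (cubeSkeleton n k 0 r) := le_dimH_skeleton hk r hr
      _ = dimH ((fun y => 0 + O y) '' cubeSkeleton n k 0 r) := by
        simp only [zero_add]
        exact (O.isometry.dimH_image _).symm
      _ ≤ _ := dimH_mono hO
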